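/- In a structured semigroup (S, N, Z), let A ⊆ S be an atlas. Then: (i) A^Z is a subsemigroup of Z (closed under multiplication); (ii) A^Z = (A^<)^Z = ^Z(A^*) = (A^Z)^Z = (s(A))^Z ⊆ s(A); (iii) if a'' ∈ A and a'' <_{a'} a for some a', a ∈ S, then a'(^ZA)a ⊆ A^Z; and (iv) if a ∈ A and a < b for some b ∈ S, then (^ZA)a = a(A^Z), where (^ZA)a = {za : z ∈ ^ZA} and a(A^Z) = {az : z ∈ A^Z}. -/

import Mathlib

open Pointwise

variable {S : Type*}

/-- `a <_s b`: the domination relation via `s`. -/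
def domBy [Semigroup S] (N Z : Set S) (a s b : S) : Prop :=
  a * s * b = a ∧ b * s * a = a ∧ a * s ∈ N ∧ s * a ∈ N ∧ b * s ∈ Z ∧ s * b ∈ Z

/-- `a < b`: domination. -/
def domRel [Semigroup S] (N Z : Set S) (a b : S) : Prop := ∃ s, domBy N Z a s b

/-- The up-closure `A^<`. -/
def upClo [Semigroup S] (N Z : Set S) (A : Set S) : Set S :=
  {b | ∃ a ∈ A, domRel N Z a b}

/-- The dual `A^*`. -/
def dualSet [Semigroup S] (N Z : Set S) (A : Set S) : Set S :=
  {s | ∃ a ∈ A, ∃ b, domBy N Z a s b}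

/-- Structured semigroup data on `(S, N, Z)`. -/
structure Structured [Semigroup S] (N Z : Set S) : Prop where
  nMul : ∀ m ∈ N, ∀ n ∈ N, m * n ∈ N
  zMul : ∀ y ∈ Z, ∀ z ∈ Z, y * z ∈ Z
  zSubN : Z ⊆ N
  zComm : ∀ z ∈ Z, ∀ n ∈ N, z * n = n * z
  binormal : ∀ a b : S, a * b ∈ Z → b * a ∈ Z → ∀ z ∈ Z, a * z * b ∈ Z ∧ b * z * a ∈ Z
  trinormal : ∀ a b : S, ∀ n ∈ N, a * b * n = n → n * a * b = n →
    a * b ∈ Z → b * a ∈ Z → b * n * a ∈ N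

/-- An atlas: `A A^* A ⊆ A ⊆ A^<`. -/
def IsAtlas [Semigroup S] (N Z : Set S) (A : Set S) : Prop :=
  A * dualSet N Z A * A ⊆ A ∧ A ⊆ upClo N Z A

/-- A coset: `A A^* A ⊆ A = A^<`. -/
def IsCoset [Semigroup S] (N Z : Set S) (A : Set S) : Prop :=
  A * dualSet N Z A * A ⊆ A ∧ upClo N Z A = A

/-- Source `s(A) = (A^* A)^<`. -/
def srcSet [Semigroup S] (N Z : Set S) (A : Set S) : Set S :=
  upClo N Z (dualSet N Z A * A)

/-- Range `r(A) = (A A^*)^<`. -/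
def rngSet [Semigroup S] (N Z : Set S) (A : Set S) : Set S :=
  upClo N Z (A * dualSet N Z A)

/-- `A|b`: `b` acts on `A` from the right. -/
def actsR [Semigroup S] (Z : Set S) (A : Set S) (b : S) : Prop :=
  ∃ b', b * b' ∈ Z ∧ b' * b ∈ Z ∧ ∃ a ∈ A, a * b * b' = a

/-- `b|A`: `b` acts on `A` from the left. -/
def actsL [Semigroup S] (Z : Set S) (b : S) (A : Set S) : Prop :=
  ∃ b', b * b' ∈ Z ∧ b' * b ∈ Z ∧ ∃ a ∈ A, b' * b * a = a

/-- `A^Z = {z ∈ Z : az = a for some a ∈ A}`. -/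
def AZset [Semigroup S] (Z : Set S) (A : Set S) : Set S :=
  {z ∈ Z | ∃ a ∈ A, a * z = a}

/-- `^Z A = {z ∈ Z : za = a for some a ∈ A}`. -/
def ZAset [Semigroup S] (Z : Set S) (A : Set S) : Set S :=
  {z ∈ Z | ∃ a ∈ A, z * a = a}

/-- The equivalence relation `a ~_A b`. -/
def eqvA [Semigroup S] (N Z : Set S) (A : Set S) (a b : S) : Prop :=
  ∃ s ∈ dualSet N Z A, ∃ t ∈ dualSet N Z A, s * a * t = s * b * t

/-- `Y` is symmetric: `ab ∈ Y → baba ∈ Y`. -/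
def IsSymmetric [Semigroup S] (Y : Set S) : Prop :=
  ∀ a b : S, a * b ∈ Y → b * a * b * a ∈ Y

/-- `D` is diagonal: `ad, d, db ∈ D → adb ∈ D`. -/
def IsDiagonal [Semigroup S] (D : Set S) : Prop :=
  ∀ a d b : S, a * d ∈ D → d ∈ D → d * b ∈ D → a * d * b ∈ D

section Domination

variable [Semigroup S] {N Z : Set S}

theorem Structured.commute (h : Structured N Z) {z n : S} (hz : z ∈ Z) (hn : n ∈ N) :
    z * n = n * z :=
  h.zComm z hz n hn

theorem domBy.trans (h : Structured N Z) {a s b t c : S} (hab : domBy N Z a s b)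
    (hbc : domBy N Z b t c) : domBy N Z a t c := by
  obtain ⟨h1, h2, h3, h4, -, -⟩ := hab
  obtain ⟨k1, k2, k3, k4, k5, k6⟩ := hbc
  refine ⟨?_, ?_, ?_, ?_, k5, k6⟩
  · rw [← h1]
    simp only [mul_assoc] at k1 ⊢
    rw [k1]
  · rw [← h2]
    simp only [← mul_assoc] at k2 ⊢
    rw [k2]
  · have := h.nMul _ h3 _ k3
    rwa [← mul_assoc, h1] at this
  · have := h.nMul _ k4 _ h4
    rwa [mul_assoc, ← mul_assoc b, h2] at this

/-- A smaller witness for a composite domination. -/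
theorem domBy.trans_mul (h : Structured N Z) {a s b t c : S} (hab : domBy N Z a s b)
    (hbc : domBy N Z b t c) : domBy N Z a (s * b * t) c := by
  obtain ⟨l1, l2, l3, l4, -, -⟩ := domBy.trans h hab hbc
  obtain ⟨h1, -, -, -, -, h6⟩ := hab
  obtain ⟨k1, -, -, -, k5, k6⟩ := hbc
  have hat : a * (s * b * t) = a * t := by
    rw [← mul_assoc, ← mul_assoc, h1]
  have hta : s * b * t * a = t * a := by
    rw [mul_assoc, h.commute h6 l4, mul_assoc, ← mul_assoc a, h1]
  refine ⟨?_, ?_, ?_, ?_, ?_, ?_⟩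
  · rw [hat, l1]
  · rw [mul_assoc, hta, ← mul_assoc, l2]
  · rwa [hat]
  · rwa [hta]
  · rw [← mul_assoc]
    exact (h.binormal c t k5 k6 _ h6).1
  · rwa [mul_assoc, mul_assoc, ← mul_assoc b, k1]

/-- Right units of an element are right units of everything it dominates. -/
theorem domBy.mul_right_unit {a s b z : S} (hab : domBy N Z a s b) (hz : b * z = b) :
    a * z = a := by
  rw [← hab.1, mul_assoc, hz]

variable {A : Set S}

theorem IsAtlas.mul_mul_mem (hA : IsAtlas N Z A) {a s b : S} (ha : a ∈ A)
    (hs : s ∈ dualSet N Z A) (hb : b ∈ A) : a * s * b ∈ A :=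
  hA.1 (Set.mul_mem_mul (Set.mul_mem_mul ha hs) hb)

theorem IsAtlas.exists_domBy (hA : IsAtlas N Z A) {b : S} (hb : b ∈ A) :
    ∃ a ∈ A, ∃ s ∈ dualSet N Z A, domBy N Z a s b := by
  obtain ⟨a, ha, s, hs⟩ := hA.2 hb
  exact ⟨a, ha, s, ⟨a, ha, b, hs⟩, hs⟩

theorem IsAtlas.AZset_mul_mem (h : Structured N Z) (hA : IsAtlas N Z A) {y z : S}
    (hy : y ∈ AZset Z A) (hz : z ∈ AZset Z A) : y * z ∈ AZset Z A := by
  obtain ⟨hyZ, a, ha, hay⟩ := hy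
  obtain ⟨hzZ, b, hb, hbz⟩ := hz
  obtain ⟨-, -, s, hs, -, -, -, -, -, hsa⟩ := hA.exists_domBy ha
  refine ⟨h.zMul _ hyZ _ hzZ, b * s * a, hA.mul_mul_mem hb hs ha, ?_⟩
  rw [← mul_assoc, mul_assoc _ a y, hay, mul_assoc b, mul_assoc,
    ← h.commute hzZ (h.zSubN hsa), ← mul_assoc, hbz]

theorem IsAtlas.AZset_upClo (hA : IsAtlas N Z A) : AZset Z (upClo N Z A) = AZset Z A := by
  ext z
  constructor
  · rintro ⟨hz, b, ⟨a, ha, s, hs⟩, hbz⟩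
    exact ⟨hz, a, ha, hs.mul_right_unit hbz⟩
  · rintro ⟨hz, a, ha, haz⟩
    exact ⟨hz, a, hA.2 ha, haz⟩

theorem IsAtlas.ZAset_dualSet (h : Structured N Z) (hA : IsAtlas N Z A) :
    ZAset Z (dualSet N Z A) = AZset Z A := by
  ext z
  constructor
  · rintro ⟨hz, s, ⟨a, ha, b, hs⟩, hzs⟩
    refine ⟨hz, a, ha, ?_⟩
    obtain ⟨h1, -, -, -, -, h6⟩ := hs
    have hsb : s * b * z = s * b := by
      rw [← h.commute hz (h.zSubN h6), ← mul_assoc, hzs]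
    rw [← h1, mul_assoc a, mul_assoc a, hsb]
  · rintro ⟨hz, c, hc, hcz⟩
    obtain ⟨b, hb, t, -, hbc⟩ := hA.exists_domBy hc
    obtain ⟨a, ha, s, -, hab⟩ := hA.exists_domBy hb
    refine ⟨hz, s * b * t, ⟨a, ha, c, hab.trans_mul h hbc⟩, ?_⟩
    rw [← mul_assoc, h.commute hz (h.zSubN hab.2.2.2.2.2), mul_assoc s,
      hbc.mul_right_unit hcz]

theorem IsAtlas.AZset_AZset (hA : IsAtlas N Z A) : AZset Z (AZset Z A) = AZset Z A := by
  ext z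
  constructor
  · rintro ⟨hz, y, ⟨-, a, ha, hay⟩, hyz⟩
    refine ⟨hz, a, ha, ?_⟩
    rw [← hay, mul_assoc, hyz]
  · rintro ⟨hz, a, ha, haz⟩
    obtain ⟨b, hb, s, -, h1, -, -, -, -, h6⟩ := hA.exists_domBy ha
    refine ⟨hz, s * a, ⟨h6, b, hb, ?_⟩, ?_⟩
    · rw [← mul_assoc, h1]
    · rw [mul_assoc, haz]

theorem IsAtlas.AZset_subset_srcSet (h : Structured N Z) (hA : IsAtlas N Z A) :
    AZset Z A ⊆ srcSet N Z A := by
  rintro z ⟨hz, a, ha, haz⟩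
  obtain ⟨b, hb, s, hs, h1, -, -, h4, -, h6⟩ := hA.exists_domBy ha
  have hyz : s * a * z = s * a := by rw [mul_assoc, haz]
  have hzy : z * (s * a) = s * a := by rw [h.commute hz (h.zSubN h6), hyz]
  have hxy : s * b * (s * a) = s * b := by
    rw [mul_assoc, ← mul_assoc b, h1]
  have hyx : s * a * (s * b) = s * b := by rw [h.commute h6 h4, hxy]
  refine ⟨s * b, Set.mul_mem_mul hs hb, s * a, ?_, ?_, ?_, ?_, ?_, ?_⟩
  · rw [hxy, mul_assoc, ← h1]
    simp only [mul_assoc, haz]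
  · rw [hzy, hyx]
  · rwa [hxy]
  · rwa [hyx]
  · rwa [hzy]
  · rwa [hyz]

theorem IsAtlas.AZset_srcSet (h : Structured N Z) (hA : IsAtlas N Z A) :
    AZset Z (srcSet N Z A) = AZset Z A := by
  apply subset_antisymm
  · rintro z ⟨hz, b, ⟨-, ⟨s, hs, a, ha, rfl⟩, t, ht⟩, hbz⟩
    obtain ⟨c, hc, -⟩ := id hs
    refine ⟨hz, c * s * a, hA.mul_mul_mem hc hs ha, ?_⟩
    have hsaz : s * a * z = s * a := ht.mul_right_unit hbz
    rw [mul_assoc c, mul_assoc c, hsaz]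
  · intro z hz
    rw [← hA.AZset_AZset] at hz
    obtain ⟨hzZ, y, hy, hyz⟩ := hz
    exact ⟨hzZ, y, hA.AZset_subset_srcSet h hy, hyz⟩

theorem IsAtlas.conj_mem_AZset (h : Structured N Z) (hA : IsAtlas N Z A) {a s b z : S}
    (ha : a ∈ A) (hab : domBy N Z a s b) (hz : z ∈ ZAset Z A) : s * z * b ∈ AZset Z A := by
  obtain ⟨hzZ, c, hc, hzc⟩ := hz
  obtain ⟨h1, -, h3, -, h5, h6⟩ := hab
  obtain ⟨-, -, t, ht, -, -, -, -, hct, -⟩ := hA.exists_domBy hc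
  refine ⟨(h.binormal b s h5 h6 z hzZ).2, c * t * a, hA.mul_mul_mem hc ht ha, ?_⟩
  calc c * t * a * (s * z * b) = c * t * (a * s * z) * b := by simp only [mul_assoc]
    _ = c * t * z * (a * s * b) := by rw [← h.commute hzZ h3]; simp only [mul_assoc]
    _ = c * t * a := by
      rw [h1, ← h.commute hzZ (h.zSubN hct), ← mul_assoc, hzc]

theorem IsAtlas.conj_mem_ZAset (h : Structured N Z) (hA : IsAtlas N Z A) {a s b z : S}
    (ha : a ∈ A) (hab : domBy N Z a s b) (hz : z ∈ AZset Z A) : b * z * s ∈ ZAset Z A := by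
  obtain ⟨hzZ, c, hc, hcz⟩ := hz
  obtain ⟨-, h2, -, h4, h5, h6⟩ := hab
  obtain ⟨-, -, t, ht, -, -, -, -, -, htc⟩ := hA.exists_domBy hc
  refine ⟨(h.binormal b s h5 h6 z hzZ).1, a * t * c, hA.mul_mul_mem ha ht hc, ?_⟩
  calc b * z * s * (a * t * c) = b * (z * (s * a)) * (t * c) := by simp only [mul_assoc]
    _ = b * s * a * (z * (t * c)) := by rw [h.commute hzZ h4]; simp only [mul_assoc]
    _ = a * t * c := by
      rw [h2, h.commute hzZ (h.zSubN htc), mul_assoc t, hcz, mul_assoc]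

theorem IsAtlas.ZAset_mul_singleton (h : Structured N Z) (hA : IsAtlas N Z A) {a b : S}
    (ha : a ∈ A) (hab : domRel N Z a b) :
    ZAset Z A * ({a} : Set S) = ({a} : Set S) * AZset Z A := by
  obtain ⟨s, hs⟩ := hab
  rw [Set.mul_singleton, Set.singleton_mul]
  apply subset_antisymm
  · rintro _ ⟨z, hz, rfl⟩
    refine ⟨s * z * b, hA.conj_mem_AZset h ha hs hz, ?_⟩
    calc a * (s * z * b) = a * s * z * b := by simp only [mul_assoc]
      _ = z * (a * s * b) := by rw [← h.commute hz.1 hs.2.2.1]; simp only [mul_assoc]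
      _ = z * a := by rw [hs.1]
  · rintro _ ⟨z, hz, rfl⟩
    refine ⟨b * z * s, hA.conj_mem_ZAset h ha hs hz, ?_⟩
    calc b * z * s * a = b * (z * (s * a)) := by simp only [mul_assoc]
      _ = b * s * a * z := by rw [h.commute hz.1 hs.2.2.2.1]; simp only [mul_assoc]
      _ = a * z := by rw [hs.2.1]

end Domination

theorem stmt17 [Semigroup S] (N Z : Set S) (h : Structured N Z) (A : Set S)
    (hA : IsAtlas N Z A) :
    (∀ y ∈ AZset Z A, ∀ z ∈ AZset Z A, y * z ∈ AZset Z A) ∧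
    AZset Z A = AZset Z (upClo N Z A) ∧
    AZset Z A = ZAset Z (dualSet N Z A) ∧
    AZset Z A = AZset Z (AZset Z A) ∧
    AZset Z A = AZset Z (srcSet N Z A) ∧
    AZset Z A ⊆ srcSet N Z A ∧
    (∀ a'' ∈ A, ∀ a' a : S, domBy N Z a'' a' a →
      ∀ z ∈ ZAset Z A, a' * z * a ∈ AZset Z A) ∧
    (∀ a ∈ A, (∃ b, domRel N Z a b) →
      ZAset Z A * ({a} : Set S) = ({a} : Set S) * AZset Z A) := by
  exact ⟨fun y hy z hz => hA.AZset_mul_mem h hy hz, hA.AZset_upClo.symm,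
    (hA.ZAset_dualSet h).symm, hA.AZset_AZset.symm, (hA.AZset_srcSet h).symm,
    hA.AZset_subset_srcSet h, fun _ ha _ _ hab _ hz => hA.conj_mem_AZset h ha hab hz,
    fun _ ha ⟨_, hab⟩ => hA.ZAset_mul_singleton h ha hab⟩
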